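/- Let d ≥ 2, s = binom(d,2), and let X be any set of s distinct points of P^2 with generic Hilbert function. Then for every t ≥ 0, H_{2X}(t) ≥ f(t), where f(t) = binom(t+2,2) if t ≤ d−1, f(t) = binom(d+1,2) + (t+1−d)d if d ≤ t ≤ 2d−3, and f(t) = 3·binom(d,2) if t ≥ 2d−2. -/

import Mathlib

open MvPolynomial

/-- The vanishing (prime) ideal of a point of ℙ²: the ideal generated by the
linear forms vanishing at the point. -/
noncomputable def pointIdeal (k : Type) [Field k] (P : Projectivization k (Fin 3 → k)) :
    Ideal (MvPolynomial (Fin 3) k) :=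
  Ideal.span {f : MvPolynomial (Fin 3) k | f.IsHomogeneous 1 ∧ eval P.rep f = 0}

/-- The Hilbert function of R/I: H(t) = dim_k R_t − dim_k I_t. -/
noncomputable def hilbertFunction (k : Type) [Field k]
    (I : Ideal (MvPolynomial (Fin 3) k)) (t : ℕ) : ℕ :=
  Module.finrank k ↥(homogeneousSubmodule (Fin 3) k t) -
    Module.finrank k ↥(Submodule.restrictScalars k I ⊓ homogeneousSubmodule (Fin 3) k t)

/-- The defining ideal `I_X` of a finite set of points. -/
noncomputable def idealOfPoints (k : Type) [Field k] {s : ℕ}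
    (P : Fin s → Projectivization k (Fin 3 → k)) : Ideal (MvPolynomial (Fin 3) k) :=
  ⨅ i, pointIdeal k (P i)

/-- The defining ideal `I_{2X}` of the double point scheme supported on a finite set of points. -/
noncomputable def doubleIdealOfPoints (k : Type) [Field k] {s : ℕ}
    (P : Fin s → Projectivization k (Fin 3 → k)) : Ideal (MvPolynomial (Fin 3) k) :=
  ⨅ i, (pointIdeal k (P i)) ^ 2

/-- `X` has generic Hilbert function: `H_X(t) = min {s, binom(t+2,2)}` for all `t`. -/
def HasGenericHilbertFunction (k : Type) [Field k] {s : ℕ}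
    (P : Fin s → Projectivization k (Fin 3 → k)) : Prop :=
  ∀ t : ℕ, hilbertFunction k (idealOfPoints k P) t = min s (Nat.choose (t + 2) 2)

/-- The forms of degree `t` vanishing to order two at each of the vectors `p i`. -/
noncomputable def doubleVanishing {k ι : Type*} [Field k] (p : ι → Fin 3 → k) (t : ℕ) :
    Submodule k (MvPolynomial (Fin 3) k) where
  carrier := {F | F.IsHomogeneous t ∧
    ∀ i, eval (p i) F = 0 ∧ ∀ j, eval (p i) (pderiv j F) = 0}
  add_mem' := fun {F G} hF hG =>
    ⟨hF.1.add hG.1, fun i => ⟨by simp [(hF.2 i).1, (hG.2 i).1],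
      fun j => by simp [(hF.2 i).2 j, (hG.2 i).2 j]⟩⟩
  zero_mem' := ⟨isHomogeneous_zero _ _ _, fun i => by simp⟩
  smul_mem' := fun c F hF =>
    ⟨(homogeneousSubmodule (Fin 3) k t).smul_mem c hF.1, fun i =>
      ⟨by simp [(hF.2 i).1, smul_eval], fun j => by simp [(hF.2 i).2 j, smul_eval]⟩⟩

/-- The linear form attached to a linear functional on `k³`. -/
noncomputable def linearForm {k : Type*} [Field k] (f : Module.Dual k (Fin 3 → k)) :
    MvPolynomial (Fin 3) k :=
  ∑ i, C (f (Pi.single i 1)) * X i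

section Forms

variable {k : Type*} [Field k]

theorem eval_linearForm (f : Module.Dual k (Fin 3 → k)) (v : Fin 3 → k) :
    eval v (linearForm f) = f v := by
  conv_rhs => rw [← Finset.univ_sum_single v]
  simp only [linearForm, map_sum, map_mul, eval_C, eval_X]
  refine Finset.sum_congr rfl fun i _ => ?_
  have : (Pi.single i (v i) : Fin 3 → k) = v i • Pi.single i 1 := by
    rw [← Pi.single_smul]; simp
  rw [this, map_smul, smul_eq_mul, mul_comm]

theorem pderiv_linearForm (f : Module.Dual k (Fin 3 → k)) (j : Fin 3) :
    pderiv j (linearForm f) = C (f (Pi.single j 1)) := by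
  simp [linearForm, pderiv_X, Pi.single_apply]

theorem isHomogeneous_linearForm (f : Module.Dual k (Fin 3 → k)) :
    (linearForm f).IsHomogeneous 1 :=
  IsHomogeneous.sum _ _ _ fun i _ => isHomogeneous_C_mul_X _ i

instance finite_homogeneousSubmodule (t : ℕ) :
    Module.Finite k (homogeneousSubmodule (Fin 3) k t) :=
  Module.Finite.iff_fg.2 (homogeneousSubmodule_fg (Fin 3) k t)

theorem finrank_homogeneousSubmodule_fin_three (t : ℕ) :
    Module.finrank k (homogeneousSubmodule (Fin 3) k t) = (t + 2).choose 2 := by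
  rw [homogeneousSubmodule_eq_finsupp_supported,
    (AddMonoidAlgebra.supportedEquivFinsupp _).finrank_eq]
  have hset : {d : Fin 3 →₀ ℕ | d.degree = t} =
      ((Finset.univ : Finset (Fin 3)).finsuppAntidiag t : Set (Fin 3 →₀ ℕ)) := by
    ext d
    simp [Finset.mem_finsuppAntidiag, Finsupp.degree_eq_sum]
  rw [hset, Module.finrank_finsupp_self]
  simp only [Finset.coe_sort_coe, Fintype.card_coe]
  rw [Finset.card_finsuppAntidiag_nat_eq_choose]
  simp only [Finset.card_univ, Fintype.card_fin]
  rw [show 3 + t - 1 = t + 2 by omega, Nat.choose_symm_add]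

theorem aeval_algebraMap_mul_of_isHomogeneous {A σ : Type*} [CommRing A] [Algebra k A]
    {F : MvPolynomial σ k} {n : ℕ} (hF : F.IsHomogeneous n) (v : σ → k) (w : A) :
    MvPolynomial.aeval (fun i => algebraMap k A (v i) * w) F = algebraMap k A (eval v F) * w ^ n := by
  rw [aeval_def, eval₂_eq, eval_eq, map_sum, Finset.sum_mul]
  refine Finset.sum_congr rfl fun d hd => ?_
  have hdeg := hF.degree_eq_sum_deg_support hd
  simp only [mul_pow, Finset.prod_mul_distrib, Finset.prod_pow_eq_pow_sum, map_mul, map_prod,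
    map_pow]
  rw [hdeg, mul_assoc]

theorem eq_mul_isHomogeneous_of_dvd {m F : MvPolynomial (Fin 3) k} {t : ℕ}
    (hm : m.IsHomogeneous 1) (hF : F.IsHomogeneous (t + 1)) (h : m ∣ F) :
    ∃ H : MvPolynomial (Fin 3) k, H.IsHomogeneous t ∧ F = m * H := by
  classical
  let _ := gradedAlgebra (σ := Fin 3) (R := k)
  obtain ⟨H, rfl⟩ := h
  have h1 := DirectSum.coe_decompose_mul_of_left_mem (homogeneousSubmodule (Fin 3) k)
    (b := H) (t + 1) (a := m) hm
  rw [if_pos (by omega), Nat.add_sub_cancel, DirectSum.decompose_of_mem_same _ hF] at h1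
  exact ⟨_, (DirectSum.decompose (homogeneousSubmodule (Fin 3) k) H t).2, h1⟩

theorem prime_linearForm {f : Module.Dual k (Fin 3 → k)} (hf : f ≠ 0) :
    Prime (linearForm f) := by
  have hne : linearForm f ≠ 0 := by
    intro h
    apply hf
    ext v
    simpa [h] using (eval_linearForm f (Pi.single v 1)).symm
  refine (irreducible_of_totalDegree_eq_one
    ((isHomogeneous_linearForm f).totalDegree hne) fun x hx => ?_).prime
  rw [isUnit_iff_ne_zero]
  rintro rfl
  exact hne (by ext i; simpa using hx i)

theorem exists_dual_apply_eq_zero [Infinite k] {ι : Type*} [Finite ι] (Q : Fin 3 → k)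
    (v : ι → Fin 3 → k) (hv : ∀ i, v i ∉ Submodule.span k {Q}) :
    ∃ f : Module.Dual k (Fin 3 → k), f Q = 0 ∧ ∀ i, f (v i) ≠ 0 := by
  obtain ⟨f, hf, hf'⟩ := Module.Dual.exists_forall_mem_ne_zero_of_forall_exists
    (Submodule.span k {Q}).dualAnnihilator (fun i => Module.Dual.eval k _ (v i)) (fun i => by
      obtain ⟨f, h1, h2⟩ := Submodule.exists_le_ker_of_notMem (hv i)
      exact ⟨f, (Submodule.mem_dualAnnihilator f).2 fun w hw => h2 hw, h1⟩)
  exact ⟨f, (Submodule.mem_dualAnnihilator f).1 hf Q (Submodule.mem_span_singleton_self Q), hf'⟩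

theorem exists_notMem_span_of_dual (f : Module.Dual k (Fin 3 → k)) (Q : Fin 3 → k) :
    ∃ v, f v = 0 ∧ v ∉ Submodule.span k {Q} := by
  by_contra! h
  have hle : LinearMap.ker f ≤ Submodule.span k {Q} := fun v hv => h v hv
  have h1 := Submodule.finrank_mono hle
  have h2 := finrank_span_le_card (R := k) ({Q} : Set (Fin 3 → k))
  have h3 := LinearMap.finrank_range_add_finrank_ker f
  have h4 := Submodule.finrank_le (LinearMap.range f)
  simp only [Set.toFinset_singleton, Finset.card_singleton, Module.finrank_self,
    Module.finrank_fin_fun] at h2 h3 h4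
  omega

end Forms

section DoubleVanishing

variable {k ι : Type*} [Field k] {p : ι → Fin 3 → k}

theorem doubleVanishing_le (p : ι → Fin 3 → k) (t : ℕ) :
    doubleVanishing p t ≤ homogeneousSubmodule (Fin 3) k t :=
  fun _ hF => hF.1

instance finite_doubleVanishing (t : ℕ) : Module.Finite k (doubleVanishing p t) :=
  Submodule.finiteDimensional_of_le (doubleVanishing_le p t)

theorem mul_mem_doubleVanishing {F G : MvPolynomial (Fin 3) k} {t : ℕ}
    (hG : G.IsHomogeneous 1) (hF : F ∈ doubleVanishing p t) :
    G * F ∈ doubleVanishing p (t + 1) := by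
  refine ⟨add_comm 1 t ▸ hG.mul hF.1, fun i => ⟨?_, fun j => ?_⟩⟩
  · simp [(hF.2 i).1]
  · simp [(hF.2 i).1, (hF.2 i).2 j]

theorem mem_doubleVanishing_of_mul_mem {m H : MvPolynomial (Fin 3) k} {t t' : ℕ}
    (hm : ∀ i, eval (p i) m ≠ 0) (hH : H.IsHomogeneous t)
    (h : m * H ∈ doubleVanishing p t') : H ∈ doubleVanishing p t := by
  have h0 : ∀ i, eval (p i) H = 0 := fun i => by
    simpa [hm i] using (h.2 i).1
  refine ⟨hH, fun i => ⟨h0 i, fun j => ?_⟩⟩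
  simpa [hm i, h0 i] using (h.2 i).2 j

theorem finrank_doubleVanishing_convex [Infinite k] [Finite ι] (hp : ∀ i, p i ≠ 0) (t : ℕ)
    (ht : 0 < Module.finrank k (doubleVanishing p (t + 1))) :
    2 * Module.finrank k (doubleVanishing p (t + 1)) + 1 ≤
      Module.finrank k (doubleVanishing p (t + 2)) +
        Module.finrank k (doubleVanishing p t) := by
  obtain ⟨F, hF, hF0⟩ := Submodule.exists_mem_ne_zero_of_ne_bot
    (p := doubleVanishing p (t + 1)) (by intro h; rw [h, finrank_bot] at ht; exact ht.false)
  obtain ⟨Q, hQ⟩ : ∃ Q, eval Q F ≠ 0 := by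
    by_contra! h
    exact hF0 (MvPolynomial.funext fun x => by simp [h x])
  have hscale : ∀ c : k, eval (c • Q) F = eval Q F * c ^ (t + 1) := fun c => by
    have := aeval_algebraMap_mul_of_isHomogeneous (A := k) hF.1 Q c
    simp only [Algebra.algebraMap_self, RingHom.id_apply] at this
    rw [← this]
    change _ = eval (fun i => Q i * c) F
    simp only [mul_comm _ c]
    rfl
  have hspan : ∀ i, p i ∉ Submodule.span k {Q} := by
    intro i hi
    obtain ⟨c, hc⟩ := Submodule.mem_span_singleton.1 hi
    have := hscale c
    rw [hc, (hF.2 i).1, eq_comm, mul_eq_zero, or_iff_right hQ] at this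
    exact hp i (by rw [← hc, eq_zero_of_pow_eq_zero this, zero_smul])
  have hQ0 : Q ≠ 0 := by
    rintro rfl
    have := hscale 0
    simp at this
    exact hQ (by simpa using this)
  obtain ⟨n, hn⟩ := Function.ne_iff.1 hQ0
  obtain ⟨u, -, hu⟩ := exists_notMem_span_of_dual 0 Q
  obtain ⟨m, hmQ, hm'⟩ := exists_dual_apply_eq_zero Q (fun o : Option ι => o.elim u p)
    (fun o => by cases o with
      | none => exact hu
      | some i => exact hspan i)
  have hm : ∀ i, m (p i) ≠ 0 := fun i => hm' (some i)
  obtain ⟨v, hmv, hv⟩ := exists_notMem_span_of_dual m Q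
  obtain ⟨l, hlQ, hl⟩ := exists_dual_apply_eq_zero Q (fun _ : Unit => v) (fun _ => hv)
  have hl := hl ()
  set V := doubleVanishing p (t + 1)
  have hm0 : m ≠ 0 := by
    rintro rfl
    exact hm' none rfl
  have hmprime : Prime (linearForm m) := prime_linearForm hm0
  have hml : ¬ linearForm m ∣ linearForm l := by
    rintro ⟨c, hc⟩
    have := congrArg (eval v) hc
    rw [map_mul, eval_linearForm, eval_linearForm, hmv, zero_mul] at this
    exact hl this
  let φ : (V × V) →ₗ[k] MvPolynomial (Fin 3) k :=
    ((LinearMap.mulLeft k (linearForm l)).comp V.subtype).coprod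
      (-((LinearMap.mulLeft k (linearForm m)).comp V.subtype))
  have hφ : ∀ x : V × V, φ x = linearForm l * x.1 - linearForm m * x.2 := fun x => by
    simp [φ, sub_eq_add_neg]
  let ψ : doubleVanishing p t →ₗ[k] V × V :=
    LinearMap.prod
      (((LinearMap.mulLeft k (linearForm m)).restrict fun G hG =>
        mul_mem_doubleVanishing (isHomogeneous_linearForm m) hG))
      (((LinearMap.mulLeft k (linearForm l)).restrict fun G hG =>
        mul_mem_doubleVanishing (isHomogeneous_linearForm l) hG))
  have hker : LinearMap.ker φ ≤ LinearMap.range ψ := by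
    rintro ⟨⟨A, hA⟩, ⟨B, hB⟩⟩ hx
    rw [LinearMap.mem_ker, hφ, sub_eq_zero] at hx
    simp only at hx
    have hdvd : linearForm m ∣ A :=
      (hmprime.dvd_or_dvd (hx ▸ dvd_mul_right _ _)).resolve_left hml
    obtain ⟨H, hH, rfl⟩ := eq_mul_isHomogeneous_of_dvd (isHomogeneous_linearForm m) hA.1 hdvd
    refine ⟨⟨H, mem_doubleVanishing_of_mul_mem (fun i => ?_) hH hA⟩, ?_⟩
    · rw [eval_linearForm]; exact hm i
    · have hB' : linearForm l * H = B := by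
        apply mul_left_cancel₀ hmprime.ne_zero
        rw [← hx]; ring
      ext1 <;> ext1
      · rfl
      · exact hB'
  have hrange : LinearMap.range φ < doubleVanishing p (t + 2) := by
    refine lt_of_le_of_ne ?_ ?_
    · rintro _ ⟨x, rfl⟩
      rw [hφ]
      exact Submodule.sub_mem _ (mul_mem_doubleVanishing (isHomogeneous_linearForm l) x.1.2)
        (mul_mem_doubleVanishing (isHomogeneous_linearForm m) x.2.2)
    · intro h
      have hmem : X n * F ∈ doubleVanishing p (t + 2) :=
        mul_mem_doubleVanishing (isHomogeneous_X k n) hF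
      rw [← h] at hmem
      obtain ⟨x, hx⟩ := hmem
      have := congrArg (eval Q) hx
      rw [hφ] at this
      simp [eval_linearForm, hlQ, hmQ] at this
      exact this.elim hn hQ
  have h1 := Submodule.finrank_lt_finrank_of_lt hrange
  have h2 := Submodule.finrank_mono hker
  have h3 := LinearMap.finrank_range_add_finrank_ker φ
  have h4 := LinearMap.finrank_range_le ψ
  rw [Module.finrank_prod] at h3
  omega

theorem finrank_doubleVanishing_add_le [CharZero k] [Fintype ι] (t : ℕ)
    (h : ∀ i, ∃ G : MvPolynomial (Fin 3) k, G.IsHomogeneous t ∧ eval (p i) G = 1 ∧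
      ∀ j ≠ i, eval (p j) G = 0 ∧ ∀ l, eval (p j) (pderiv l G) = 0) :
    Module.finrank k (doubleVanishing p (t + 1)) + 3 * Fintype.card ι ≤ (t + 3).choose 2 := by
  classical
  let J : MvPolynomial (Fin 3) k →ₗ[k] (ι → Fin 3 → k) :=
    LinearMap.pi fun i => LinearMap.pi fun j =>
      (aeval (R := k) (p i)).toLinearMap.comp (pderiv j).toLinearMap
  have hJ : ∀ F i j, J F i j = eval (p i) (pderiv j F) := fun F i j => by
    simp [J]
  let J' := J.domRestrict (homogeneousSubmodule (Fin 3) k (t + 1))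
  have hsingle : ∀ i (w : Fin 3 → k), Pi.single i w ∈ LinearMap.range J' := by
    intro i w
    obtain ⟨G, hG, hG1, hG0⟩ := h i
    have heuler : ∑ j, p i j * eval (p i) (pderiv j G) = t := by
      simpa [hG1] using congrArg (eval (p i)) hG.sum_X_mul_pderiv
    set β : k := (∑ j, p i j * w j) / (t + 1) with hβ
    have ht : (t + 1 : k) ≠ 0 := by exact_mod_cast t.succ_ne_zero
    let f : Module.Dual k (Fin 3 → k) :=
      Fintype.linearCombination k fun j => w j - β * eval (p i) (pderiv j G)
    have hfs : ∀ j, f (Pi.single j 1) = w j - β * eval (p i) (pderiv j G) := fun j => by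
      simp [f]
    have hfp : f (p i) = β := by
      simp only [f, Fintype.linearCombination_apply, smul_eq_mul, mul_sub,
        Finset.sum_sub_distrib]
      simp only [mul_left_comm _ β, ← Finset.mul_sum, heuler]
      rw [hβ]; field_simp; ring
    refine ⟨⟨linearForm f * G, add_comm 1 t ▸ (isHomogeneous_linearForm f).mul hG⟩, ?_⟩
    funext i' j
    change J (linearForm f * G) i' j = _
    rw [hJ, Derivation.leibniz, pderiv_linearForm, hfs]
    simp only [smul_eq_mul, map_add, map_mul, eval_linearForm, eval_C]
    rcases eq_or_ne i' i with rfl | hne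
    · simp [hfp, hG1]
    · simp [hne, hG0 i' hne]
  have hsurj : LinearMap.range J' = ⊤ := by
    refine eq_top_iff.2 fun w _ => ?_
    rw [← Finset.univ_sum_single w]
    exact Submodule.sum_mem _ fun i _ => hsingle i (w i)
  have h1 := LinearMap.finrank_range_add_finrank_ker J'
  rw [hsurj, finrank_top, finrank_homogeneousSubmodule_fin_three,
    show t + 1 + 2 = t + 3 by ring] at h1
  have h2 : doubleVanishing p (t + 1) ≤
      (LinearMap.ker J').map (homogeneousSubmodule (Fin 3) k (t + 1)).subtype := by
    intro F hF
    refine ⟨⟨F, hF.1⟩, ?_, rfl⟩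
    rw [SetLike.mem_coe, LinearMap.mem_ker]
    funext i j
    exact (hJ F i j).trans ((hF.2 i).2 j)
  have h3 := Submodule.finrank_mono h2
  have h4 := Submodule.finrank_map_le (homogeneousSubmodule (Fin 3) k (t + 1)).subtype
    (LinearMap.ker J')
  have h5 : Module.finrank k (ι → Fin 3 → k) = 3 * Fintype.card ι := by
    rw [Module.finrank_pi_fintype]; simp [mul_comm]
  rw [h5] at h1
  omega

end DoubleVanishing

section PointIdeal

variable {k : Type} [Field k]

theorem eval_eq_zero_of_mem_pointIdeal {P : Projectivization k (Fin 3 → k)}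
    {F : MvPolynomial (Fin 3) k} (hF : F ∈ pointIdeal k P) : eval P.rep F = 0 := by
  have : pointIdeal k P ≤ RingHom.ker (eval P.rep) := Ideal.span_le.2 fun f hf => hf.2
  exact this hF

theorem eval_pderiv_eq_zero_of_mem_pointIdeal_sq {P : Projectivization k (Fin 3 → k)}
    {F : MvPolynomial (Fin 3) k} (hF : F ∈ pointIdeal k P ^ 2) (j : Fin 3) :
    eval P.rep (pderiv j F) = 0 := by
  rw [pow_two] at hF
  refine Submodule.mul_induction_on hF (fun a ha b hb => ?_) (fun a b ha hb => ?_)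
  · simp [eval_eq_zero_of_mem_pointIdeal ha, eval_eq_zero_of_mem_pointIdeal hb]
  · simp [ha, hb]

theorem mem_pointIdeal_of_eval_eq_zero {P : Projectivization k (Fin 3 → k)}
    {F : MvPolynomial (Fin 3) k} {n : ℕ} (hF : F.IsHomogeneous n) (h : eval P.rep F = 0) :
    F ∈ pointIdeal k P := by
  obtain ⟨j, hj⟩ := Function.ne_iff.1 P.rep_nonzero
  let π := Ideal.Quotient.mkₐ k (pointIdeal k P)
  have hX : ∀ i, π (X i) = algebraMap k _ (P.rep i) * (algebraMap k _ (P.rep j)⁻¹ * π (X j)) := by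
    intro i
    rw [← mul_assoc, ← map_mul, ← Algebra.smul_def, ← map_smul, ← sub_eq_zero, ← map_sub]
    refine Ideal.Quotient.eq_zero_iff_mem.2 (Ideal.subset_span ⟨?_, ?_⟩)
    · rw [smul_eq_C_mul]
      exact (isHomogeneous_X k i).sub (isHomogeneous_C_mul_X _ j)
    · have hj : P.rep j ≠ 0 := hj
      simp [smul_eval, hj]
  have h1 := aeval_algebraMap_mul_of_isHomogeneous hF P.rep (algebraMap k _ (P.rep j)⁻¹ * π (X j))
  rw [h, map_zero, zero_mul] at h1
  refine Ideal.Quotient.eq_zero_iff_mem.1 ?_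
  change π F = 0
  rw [← h1, ← _root_.funext hX]
  exact congrArg (fun g : _ →ₐ[k] _ => g F) (aeval_unique π)

theorem inf_le_doubleVanishing {s : ℕ} (P : Fin s → Projectivization k (Fin 3 → k)) (t : ℕ) :
    Submodule.restrictScalars k (doubleIdealOfPoints k P) ⊓ homogeneousSubmodule (Fin 3) k t ≤
      doubleVanishing (fun i => (P i).rep) t := by
  rintro F ⟨hF, hFt⟩
  have hF : ∀ i, F ∈ pointIdeal k (P i) ^ 2 := by
    simpa [doubleIdealOfPoints, Ideal.mem_iInf] using hF
  exact ⟨hFt, fun i => ⟨eval_eq_zero_of_mem_pointIdeal (Ideal.pow_le_self two_ne_zero (hF i)),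
    eval_pderiv_eq_zero_of_mem_pointIdeal_sq (hF i)⟩⟩

theorem choose_sub_finrank_le_hilbertFunction {s : ℕ}
    (P : Fin s → Projectivization k (Fin 3 → k)) (t : ℕ) :
    (t + 2).choose 2 - Module.finrank k (doubleVanishing (fun i => (P i).rep) t) ≤
      hilbertFunction k (doubleIdealOfPoints k P) t := by
  rw [hilbertFunction, finrank_homogeneousSubmodule_fin_three]
  exact Nat.sub_le_sub_left (Submodule.finrank_mono (inf_le_doubleVanishing P t)) _

/-- A form of degree `e ≤ n` vanishing at the points is zero when the points impose
independent conditions on all forms of degree `n`. -/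
theorem eq_zero_of_hilbertFunction_eq {s n e : ℕ} {P : Fin s → Projectivization k (Fin 3 → k)}
    (h : hilbertFunction k (idealOfPoints k P) n = (n + 2).choose 2) (he : e ≤ n)
    {F : MvPolynomial (Fin 3) k} (hF : F.IsHomogeneous e)
    (hF0 : ∀ i, eval (P i).rep F = 0) : F = 0 := by
  set W := Submodule.restrictScalars k (idealOfPoints k P) ⊓ homogeneousSubmodule (Fin 3) k n
    with hW
  have hle : W ≤ homogeneousSubmodule (Fin 3) k n := inf_le_right
  have : Module.Finite k W := Submodule.finiteDimensional_of_le hle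
  have h1 := Submodule.finrank_mono hle
  have hpos : 0 < (n + 2).choose 2 := Nat.choose_pos (by omega)
  rw [hilbertFunction, ← hW] at h
  rw [finrank_homogeneousSubmodule_fin_three] at h h1
  have hbot : W = ⊥ := Submodule.finrank_eq_zero.1 (by omega)
  have hmem : X 0 ^ (n - e) * F ∈ W := by
    refine ⟨?_, ?_⟩
    · have : ∀ i, F ∈ pointIdeal k (P i) := fun i => mem_pointIdeal_of_eval_eq_zero hF (hF0 i)
      exact Ideal.mul_mem_left _ _ (by simpa [idealOfPoints, Ideal.mem_iInf] using this)
    · have := (isHomogeneous_X_pow (R := k) (0 : Fin 3) (n - e)).mul hF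
      rwa [Nat.sub_add_cancel he] at this
  rw [hbot, Submodule.mem_bot, mul_eq_zero] at hmem
  exact hmem.resolve_left (pow_ne_zero _ (X_ne_zero 0))

theorem exists_isHomogeneous_eval_eq {s n : ℕ} {P : Fin s → Projectivization k (Fin 3 → k)}
    (h : hilbertFunction k (idealOfPoints k P) n = (n + 2).choose 2)
    (hs : s = (n + 2).choose 2) (w : Fin s → k) :
    ∃ S : MvPolynomial (Fin 3) k, S.IsHomogeneous n ∧ ∀ i, eval (P i).rep S = w i := by
  let E : homogeneousSubmodule (Fin 3) k n →ₗ[k] (Fin s → k) :=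
    (LinearMap.pi fun i => (aeval (R := k) (P i).rep).toLinearMap).domRestrict _
  have hE : ∀ F i, E F i = eval (P i).rep F.1 := fun F i => by
    simp [E]
  have hinj : Function.Injective E := by
    refine (injective_iff_map_eq_zero E).2 fun F hF => Subtype.ext ?_
    exact eq_zero_of_hilbertFunction_eq h le_rfl F.2 fun i => by rw [← hE, hF]; rfl
  have hsurj := (LinearMap.injective_iff_surjective_of_finrank_eq_finrank
    (by rw [finrank_homogeneousSubmodule_fin_three]; simp [hs])).1 hinj
  obtain ⟨S, hS⟩ := hsurj w
  exact ⟨S.1, S.2, fun i => by rw [← hE, hS]⟩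

theorem doubleVanishing_eq_bot [CharZero k] {s n t : ℕ}
    {P : Fin s → Projectivization k (Fin 3 → k)}
    (h : hilbertFunction k (idealOfPoints k P) n = (n + 2).choose 2) (ht : t ≤ n + 1) :
    doubleVanishing (fun i => (P i).rep) t = ⊥ := by
  refine (Submodule.eq_bot_iff _).2 fun F hF => ?_
  rcases Nat.eq_zero_or_pos t with rfl | htpos
  · exact eq_zero_of_hilbertFunction_eq h (Nat.zero_le n) hF.1 fun i => (hF.2 i).1
  · have hder : ∀ j, pderiv j F = 0 := fun j =>
      eq_zero_of_hilbertFunction_eq h (by omega) hF.1.pderiv fun i => (hF.2 i).2 j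
    have := hF.1.sum_X_mul_pderiv
    simp only [hder, mul_zero, Finset.sum_const_zero] at this
    exact (smul_eq_zero.1 this.symm).resolve_left htpos.ne'

theorem finrank_doubleVanishing_add_le_of_generic [CharZero k] {s n t : ℕ}
    {P : Fin s → Projectivization k (Fin 3 → k)}
    (h : hilbertFunction k (idealOfPoints k P) n = (n + 2).choose 2)
    (hs : s = (n + 2).choose 2) (ht : 2 * n ≤ t) :
    Module.finrank k (doubleVanishing (fun i => (P i).rep) (t + 1)) + 3 * s ≤
      (t + 3).choose 2 := by
  classical
  have := finrank_doubleVanishing_add_le (p := fun i => (P i).rep) t fun i => ?_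
  · rwa [Fintype.card_fin] at this
  obtain ⟨S, hS, hSw⟩ := exists_isHomogeneous_eval_eq h hs (Pi.single i 1)
  obtain ⟨j, hj⟩ := Function.ne_iff.1 (P i).rep_nonzero
  have hj : (P i).rep j ≠ 0 := hj
  refine ⟨(C ((P i).rep j)⁻¹ * X j) ^ (t - 2 * n) * S ^ 2, ?_, ?_, fun i' hi' => ⟨?_, fun l => ?_⟩⟩
  · have := ((isHomogeneous_C_mul_X ((P i).rep j)⁻¹ j).pow (t - 2 * n)).mul (hS.pow 2)
    rwa [show 1 * (t - 2 * n) + n * 2 = t by omega] at this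
  · simp [hSw, hj]
  · simp [hSw, hi']
  · simp [hSw, hi', pow_two]

end PointIdeal

theorem nonneg_of_difference_antitone_once_nonpos {e : ℕ → ℤ} (h0 : 0 ≤ e 0)
    (h : ∀ n, 0 < e (n + 1) - e n ∨ e (n + 2) - e (n + 1) ≤ e (n + 1) - e n)
    {n m : ℕ} (hnm : n ≤ m) (hm : 0 ≤ e m) : 0 ≤ e n := by
  have hfwd : ∀ a, e (a + 1) - e a < 0 → ∀ b, e (a + b + 1) - e (a + b) < 0 := by
    intro a ha b
    induction b with
    | zero => exact ha
    | succ b ih =>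
      have := h (a + b)
      rw [show a + (b + 1) + 1 = a + b + 2 by ring, show a + (b + 1) = a + b + 1 by ring]
      omega
  by_contra! hn
  obtain ⟨a, han, ha⟩ : ∃ a < n, e (a + 1) - e a < 0 := by
    by_contra! hc
    have : ∀ b ≤ n, 0 ≤ e b := by
      intro b hb
      induction b with
      | zero => exact h0
      | succ b ih => have := hc b hb; have := ih (by omega); omega
    exact absurd (this n le_rfl) (by omega)
  have : ∀ c, e (n + c) < 0 := by
    intro c
    induction c with
    | zero => exact hn
    | succ c ih =>
      have := hfwd a ha (n + c - a)
      rw [show a + (n + c - a) = n + c by omega] at this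
      rw [← add_assoc]
      omega
  have := this (m - n)
  rw [Nat.add_sub_cancel' hnm] at this
  omega

/-- If X is any set of binom(d,2) points of ℙ² (d ≥ 2) with generic Hilbert
function, then H_{2X}(t) ≥ f(t), where f(t) = binom(t+2,2) for t ≤ d−1,
f(t) = binom(d+1,2) + (t+1−d)d for d ≤ t ≤ 2d−3, and f(t) = 3·binom(d,2) for t ≥ 2d−2. -/
theorem statement13 (k : Type) [Field k] [IsAlgClosed k] [CharZero k]
    (d : ℕ) (hd : 2 ≤ d)
    (P : Fin (Nat.choose d 2) → Projectivization k (Fin 3 → k))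
    (hinj : Function.Injective P) (hgen : HasGenericHilbertFunction k P) :
    ∀ t : ℕ,
      (if t ≤ d - 1 then Nat.choose (t + 2) 2
        else if t ≤ 2 * d - 3 then Nat.choose (d + 1) 2 + (t + 1 - d) * d
        else 3 * Nat.choose d 2)
      ≤ hilbertFunction k (doubleIdealOfPoints k P) t := by
  obtain ⟨n, rfl⟩ : ∃ n, d = n + 2 := ⟨d - 2, by omega⟩
  have hH : hilbertFunction k (idealOfPoints k P) n = (n + 2).choose 2 := by
    rw [hgen n, min_self]
  set a : ℕ → ℕ := fun t => Module.finrank k (doubleVanishing (fun i => (P i).rep) t) with ha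
  have hlow : ∀ t ≤ n + 1, a t = 0 := fun t ht => by
    simp only [ha]
    rw [doubleVanishing_eq_bot hH ht, finrank_bot]
  have hhigh : ∀ t, 2 * n ≤ t → a (t + 1) + 3 * (n + 2).choose 2 ≤ (t + 3).choose 2 :=
    fun t ht => finrank_doubleVanishing_add_le_of_generic hH rfl ht
  have hconv : ∀ t, 0 < a (t + 1) → 2 * a (t + 1) + 1 ≤ a (t + 2) + a t := fun t ht =>
    finrank_doubleVanishing_convex (fun i => (P i).rep_nonzero) t ht
  have hchoose : ∀ t, (t + 1).choose 2 = t + t.choose 2 := fun t => by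
    rw [Nat.choose_succ_succ' t 1, Nat.choose_one_right]
  intro t
  refine le_trans ?_ (choose_sub_finrank_le_hilbertFunction P t)
  change _ ≤ (t + 2).choose 2 - a t
  split_ifs with h1 h2
  · rw [hlow t (by omega), Nat.sub_zero]
  · let e : ℕ → ℤ := fun i =>
      ((n + 1 + i + 2).choose 2 : ℤ) - a (n + 1 + i) - ((n + 3).choose 2 + i * (n + 2))
    have he : 0 ≤ e (t - (n + 1)) := by
      refine nonneg_of_difference_antitone_once_nonpos (m := n) ?_ (fun i => ?_) (by omega) ?_
      · simp [e, hlow (n + 1) le_rfl]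
      · have hN1 := hchoose (n + 1 + i + 2)
        have hN2 := hchoose (n + 1 + i + 3)
        have hc := hconv (n + 1 + i)
        simp only [e, ← add_assoc]
        simp only [show n + 1 + i + 1 + 2 = n + 1 + i + 2 + 1 by ring,
          show n + 1 + i + 2 + 2 = n + 1 + i + 3 + 1 by ring, hN1, hN2] at *
        push_cast at *
        rcases Nat.eq_zero_or_pos (a (n + 1 + i + 1)) with h0 | hpos
        · left
          rw [h0]
          push_cast
          nlinarith
        · right
          have := hc hpos
          zify at *
          nlinarith
      · have := hhigh (2 * n) le_rfl
        have hs := hchoose (n + 2)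
        have hs2 : 2 * (n + 2).choose 2 = (n + 2) * (n + 1) := by
          rw [Nat.choose_two_right]
          exact Nat.mul_div_cancel' (Nat.even_mul_pred_self (n + 2)).two_dvd
        simp only [e]
        rw [show n + 1 + n + 2 = 2 * n + 3 by ring, show n + 1 + n = 2 * n + 1 by ring]
        zify at *
        rw [hs]
        nlinarith
    simp only [e] at he
    rw [show n + 1 + (t - (n + 1)) = t by omega] at he
    rw [show t + 1 - (n + 2) = t - (n + 1) by omega]
    zify
    have : ((t + 2).choose 2 : ℤ) - a t ≤ (((t + 2).choose 2 - a t : ℕ) : ℤ) := by omega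
    push_cast at *
    linarith
  · obtain ⟨u, rfl⟩ : ∃ u, t = u + 1 := ⟨t - 1, by omega⟩
    have := hhigh u (by omega)
    change _ ≤ (u + 3).choose 2 - _
    omega
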